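/- arXiv:2506.04092 — 2 statements merged into one kernel-verified Lean document; each statement's English description precedes it below -/
import Mathlib

section
/- ℳ_order is not incentive compatible with respect to the national cycle limits: there exist an IKEP instance ⟨G,V,Γ⟩ with Γ=(n,icl,ncl,iss,isn), a country j, and a parameter set Γ'' = (n,icl,ncl'',iss,isn) with ncl''_j < ncl_j and ncl''_h = ncl_h for every h ≠ j, such that for every pre-selection function σ, U_j(ℳ_order(⟨G,V,Γ''⟩)) > U_j(ℳ_order(⟨G,V,Γ⟩)); that is, country j can strictly increase its expected utility by reporting a lower national cycle limit. -/
open scoped Classical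

/-- An `n`-partitioned compatibility graph: a finite directed graph on a finite
set of natural-number vertices, without self-loops, whose vertex set is
partitioned into `n` nonempty countries. -/
structure PartGraph (n : ℕ) where
  verts : Finset ℕ
  arcs : Finset (ℕ × ℕ)
  arcs_mem : ∀ p ∈ arcs, p.1 ∈ verts ∧ p.2 ∈ verts
  no_loops : ∀ v, (v, v) ∉ arcs
  country : ℕ → Fin n
  country_nonempty : ∀ i : Fin n, ∃ v ∈ verts, country v = i

/-- Cyclic access to the entries of a list. -/
def cyc (l : List ℕ) (k : ℕ) : ℕ := l.getD (k % l.length) 0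

/-- `l` is a (directed) cycle of `G`: a cyclic sequence of at least two distinct
vertices, consecutive ones (cyclically) joined by arcs. -/
def IsCycle {n : ℕ} (G : PartGraph n) (l : List ℕ) : Prop :=
  2 ≤ l.length ∧ l.Nodup ∧ (∀ v ∈ l, v ∈ G.verts) ∧
    ∀ k < l.length, (cyc l k, cyc l (k + 1)) ∈ G.arcs

/-- All vertices of `l` belong to country `i`. -/
def IsNationalTo {n : ℕ} (G : PartGraph n) (l : List ℕ) (i : Fin n) : Prop :=
  ∀ v ∈ l, G.country v = i

/-- A national cycle: all vertices in one country. -/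
def IsNational {n : ℕ} (G : PartGraph n) (l : List ℕ) : Prop :=
  ∃ i, IsNationalTo G l i

/-- An international cycle: not national (equivalently, for cycles, it contains
an international arc). -/
def IsInternational {n : ℕ} (G : PartGraph n) (l : List ℕ) : Prop :=
  ¬ IsNational G l

/-- Position `k` (taken cyclically) is the start of a `V_i`-segment of `l`:
the vertex there is in country `i` but the cyclically preceding one is not. -/
def segStart {n : ℕ} (G : PartGraph n) (l : List ℕ) (i : Fin n) (k : ℕ) : Prop :=
  G.country (cyc l k) = i ∧ G.country (cyc l (k + l.length - 1)) ≠ i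

/-- The size of the run of consecutive (cyclic) positions of `l`, starting at
position `k`, whose vertices are in country `i`.  At a segment start this is
exactly the size of that `V_i`-segment. -/
noncomputable def runLen {n : ℕ} (G : PartGraph n) (l : List ℕ) (i : Fin n) (k : ℕ) : ℕ :=
  ((Finset.range l.length).filter
    fun j => ∀ j' ≤ j, G.country (cyc l (k + j')) = i).card

/-- The number of `V_i`-segments of the cycle `l`. -/
noncomputable def numSegs {n : ℕ} (G : PartGraph n) (l : List ℕ) (i : Fin n) : ℕ :=
  ((Finset.range l.length).filter fun k => segStart G l i k).card

/-- A set `Γ` of country-specific parameters for `n` countries. -/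
structure Params (n : ℕ) where
  icl : ℕ∞
  ncl : Fin n → ℕ∞
  iss : Fin n → ℕ∞
  isn : Fin n → ℕ∞
  icl_ne_one : icl ≠ 1
  ncl_ne_one : ∀ i, ncl i ≠ 1
  iss_pos : ∀ i, 1 ≤ iss i
  isn_pos : ∀ i, 1 ≤ isn i

/-- `l` is a `Γ`-cycle of `(G, 𝒱)`. -/
def IsGammaCycle {n : ℕ} (G : PartGraph n) (Γ : Params n) (l : List ℕ) : Prop :=
  IsCycle G l ∧
    ((∃ i, IsNationalTo G l i ∧ (l.length : ℕ∞) ≤ Γ.ncl i) ∨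
      (IsInternational G l ∧ (l.length : ℕ∞) ≤ Γ.icl ∧
        (∀ i, ∀ k < l.length, segStart G l i k → (runLen G l i k : ℕ∞) ≤ Γ.iss i) ∧
        (∀ i, (numSegs G l i : ℕ∞) ≤ Γ.isn i)))

/-- A cycle packing of `G`: a set of pairwise vertex-disjoint cycles. -/
def IsPacking {n : ℕ} (G : PartGraph n) (P : Finset (List ℕ)) : Prop :=
  (∀ l ∈ P, IsCycle G l) ∧
    ∀ l ∈ P, ∀ l' ∈ P, l ≠ l' → ∀ v ∈ l, v ∉ l'

/-- The size of a cycle packing: total number of arcs (= vertices) of its cycles. -/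
def packSize (P : Finset (List ℕ)) : ℕ := ∑ l ∈ P, l.length

/-- A `Γ`-cycle packing of `(G, 𝒱)`. -/
def IsGammaPackingG {n : ℕ} (G : PartGraph n) (Γ : Params n) (P : Finset (List ℕ)) : Prop :=
  IsPacking G P ∧ ∀ l ∈ P, IsGammaCycle G Γ l


/-- An IKEP instance `I = ⟨G, 𝒱, Γ⟩`. -/
structure IKEP where
  n : ℕ
  npos : 1 ≤ n
  G : PartGraph n
  prm : Params n

/-- A `Γ`-cycle packing of the instance `I`. -/
def IsGammaPacking (I : IKEP) (P : Finset (List ℕ)) : Prop :=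
  IsGammaPackingG I.G I.prm P

/-- The utility `u_i(C)` of country `i` from the cycle `C`: the number of arcs
of `C` entering country `i`, i.e. the number of vertices of `C` in country `i`. -/
noncomputable def cycUtil {n : ℕ} (G : PartGraph n) (i : Fin n) (l : List ℕ) : ℕ :=
  (l.filter fun v => G.country v = i).length

/-- The utility `u_i(𝒞)` of country `i` from a cycle packing. -/
noncomputable def packUtil {n : ℕ} (G : PartGraph n) (i : Fin n) (P : Finset (List ℕ)) : ℕ :=
  ∑ l ∈ P, cycUtil G i l

/-- `opt(I)`: the maximum size of a `Γ`-cycle packing of `G`. -/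
noncomputable def optSize (I : IKEP) : ℕ :=
  sSup {m | ∃ P, IsGammaPacking I P ∧ packSize P = m}

/-- `nat_i(I)`: the maximum size of a `Γ`-cycle packing of the subgraph
`G[V_i]` induced by country `i` (all its cycles are national, so the only
constraint from `Γ` is the national cycle limit `ncl i`). -/
noncomputable def natSize (I : IKEP) (i : Fin I.n) : ℕ :=
  sSup {m | ∃ P, IsPacking I.G P ∧ (∀ l ∈ P, IsNationalTo I.G l i) ∧
    (∀ l ∈ P, (l.length : ℕ∞) ≤ I.prm.ncl i) ∧ packSize P = m}

/-- A (randomised) mechanism: for every IKEP instance it returns one `Γ`-cycle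
packing according to a (finitely supported) probability distribution on the
set `𝒟_I` of all `Γ`-cycle packings of `G`. -/
structure Mechanism where
  dist : IKEP → (Finset (List ℕ) →₀ ℝ)
  nonneg : ∀ I P, 0 ≤ dist I P
  sum_one : ∀ I, ((dist I).sum fun _ p => p) = 1
  supp : ∀ I P, dist I P ≠ 0 → IsGammaPacking I P

/-- The expected utility `U_i(ℳ(I))` of country `i`. -/
noncomputable def expUtil (M : Mechanism) (I : IKEP) (i : Fin I.n) : ℝ :=
  (M.dist I).sum fun P p => p * (packUtil I.G i P : ℝ)

/-- The expected social welfare `SW(ℳ(I)) = Σ_i U_i(ℳ(I))`: the expected size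
of the returned packing. -/
noncomputable def sw (M : Mechanism) (I : IKEP) : ℝ :=
  (M.dist I).sum fun P p => p * (packSize P : ℝ)

/-- Individual rationality. -/
def IndRational (M : Mechanism) : Prop :=
  ∀ I : IKEP, ∀ i : Fin I.n, (natSize I i : ℝ) ≤ expUtil M I i

/-- Efficiency. -/
def Efficient (M : Mechanism) : Prop :=
  ∀ I : IKEP, sw M I = (optSize I : ℝ)

/-- `Γ' ≤ᵢ Γ`: country `i` misreports by declaring (weakly) smaller
international segment size and segment number; all other parameters agree. -/
def ParamLE {n : ℕ} (i : Fin n) (Γ' Γ : Params n) : Prop :=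
  Γ'.icl = Γ.icl ∧ Γ'.ncl = Γ.ncl ∧
    Γ'.iss i ≤ Γ.iss i ∧ Γ'.isn i ≤ Γ.isn i ∧
    (∀ h, h ≠ i → Γ'.iss h = Γ.iss h) ∧ (∀ h, h ≠ i → Γ'.isn h = Γ.isn h)

/-- Incentive compatibility (with respect to segment size and segment number). -/
def IncentiveCompatible (M : Mechanism) : Prop :=
  ∀ I : IKEP, ∀ i : Fin I.n, ∀ Γ' : Params I.n, ParamLE i Γ' I.prm →
    expUtil M { I with prm := Γ' } i ≤ expUtil M I i

/-- An international `Γ`-cycle of the instance `I`. -/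
def IsIntlGammaCycle (I : IKEP) (l : List ℕ) : Prop :=
  IsGammaCycle I.G I.prm l ∧ IsInternational I.G l

/-- `c_int(I)`: the maximum length of an international `Γ`-cycle of `G`. -/
noncomputable def cInt (I : IKEP) : ℕ :=
  sSup {s | ∃ l, IsIntlGammaCycle I l ∧ l.length = s}


/-! ### The mechanism `ℳ_order` -/

/-- Nodup lists with entries in a fixed finite set form a finite set. -/
lemma finite_nodup_lists (s : Finset ℕ) :
    {l : List ℕ | l.Nodup ∧ ∀ x ∈ l, x ∈ s}.Finite := by
  classical
  have h : {l : List ℕ | l.Nodup ∧ ∀ x ∈ l, x ∈ s} ⊆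
      Set.range fun l : {l : List {x : ℕ // x ∈ s} // l.Nodup} =>
        l.1.map Subtype.val := by
    rintro l ⟨hnd, hmem⟩
    refine ⟨⟨l.attach.map fun x => ⟨x.1, hmem x.1 x.2⟩, ?_⟩, ?_⟩
    · refine (List.nodup_attach.mpr hnd).map ?_
      intro x y hxy
      have h2 := congrArg Subtype.val hxy
      exact Subtype.ext h2
    · simp [List.map_map, Function.comp]
  exact (Set.finite_range _).subset h

/-- The canonical list representation of a cycle: the one (among its
rotations) starting at its smallest vertex.  Working with canonical
representatives identifies lists up to rotation, i.e. identifies the abstract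
cycles. -/
def IsCanon (l : List ℕ) : Prop := ∀ v ∈ l, l.headI ≤ v

/-- Membership in `𝒳(Ĝ)`: `l` is (the canonical representation of) an
international cycle of `G` of length at most `icl` all of whose vertices
belong to `avail` (the vertices of `Ĝ`). -/
def XCond {n : ℕ} (G : PartGraph n) (icl : ℕ∞) (avail : Finset ℕ) (l : List ℕ) : Prop :=
  IsCycle G l ∧ (∀ v ∈ l, v ∈ avail) ∧ IsInternational G l ∧
    (l.length : ℕ∞) ≤ icl ∧ IsCanon l

lemma XCond_finite {n : ℕ} (G : PartGraph n) (icl : ℕ∞) (avail : Finset ℕ) :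
    {l | XCond G icl avail l}.Finite :=
  (finite_nodup_lists avail).subset fun _ hl => ⟨hl.1.2.1, hl.2.1⟩

/-- The set `𝒳(Ĝ)`, listed in some fixed order. -/
noncomputable def XList {n : ℕ} (G : PartGraph n) (icl : ℕ∞) (avail : Finset ℕ) :
    List (List ℕ) :=
  (XCond_finite G icl avail).toFinset.toList

/-- `l` is (the canonical representation of) a substitute for the cycle `C`:
an international `Γ`-cycle of `G` whose vertex set is contained in that of `C`
and which has at most one `V_i`-segment for every country `i`. -/
def SubCond {n : ℕ} (G : PartGraph n) (Γ : Params n) (C l : List ℕ) : Prop :=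
  IsGammaCycle G Γ l ∧ IsInternational G l ∧ (∀ v ∈ l, v ∈ C) ∧
    (∀ i, numSegs G l i ≤ 1) ∧ IsCanon l

lemma SubCond_finite {n : ℕ} (G : PartGraph n) (Γ : Params n) (C : List ℕ) :
    {l | SubCond G Γ C l}.Finite :=
  (finite_nodup_lists C.toFinset).subset fun _ hl =>
    ⟨hl.1.1.2.1, fun x hx => List.mem_toFinset.mpr (hl.2.2.1 x hx)⟩

/-- The substitutes for `C`, listed in some fixed order. -/
noncomputable def subList {n : ℕ} (G : PartGraph n) (Γ : Params n) (C : List ℕ) :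
    List (List ℕ) :=
  (SubCond_finite G Γ C).toFinset.toList

/-- `c` is vertex-disjoint from all cycles in `acc`. -/
def DisjFrom (acc : List (List ℕ)) (c : List ℕ) : Prop :=
  ∀ a ∈ acc, ∀ v ∈ c, v ∉ a

/-- Step 4 of `ℳ_order`: scan the ordering and greedily collect pairwise
vertex-disjoint cycles. -/
noncomputable def greedy : List (List ℕ) → List (List ℕ) → List (List ℕ)
  | acc, [] => acc
  | acc, c :: rest => if DisjFrom acc c then greedy (c :: acc) rest else greedy acc rest

/-- Step 5 of `ℳ_order`, in expectation: process the greedily selected cycles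
one by one (keeping `Γ`-cycles, replacing turnable non-`Γ`-cycles by a
uniformly random substitute, deleting the rest), finally accumulating them
into `acc` (initialised with `𝒞_nat`), and return the expected value of `f`
of the resulting packing. -/
noncomputable def stepExp {n : ℕ} (G : PartGraph n) (Γ : Params n)
    (f : Finset (List ℕ) → ℝ) : List (List ℕ) → Finset (List ℕ) → ℝ
  | [], acc => f acc
  | C :: rest, acc =>
    if IsGammaCycle G Γ C then stepExp G Γ f rest (insert C acc)
    else if subList G Γ C ≠ [] then
      (((subList G Γ C).map fun D => stepExp G Γ f rest (insert D acc)).sum) /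
        ((subList G Γ C).length : ℝ)
    else stepExp G Γ f rest acc

/-- The expected value of `f` of the packing returned by `ℳ_order` on input
`I`, given that Step 1 pre-selected the national packing `Cnat`: the ordering
of `𝒳(Ĝ)` in Step 3 is uniformly random, and the substitutes in Step 5 are
chosen independently and uniformly at random. -/
noncomputable def MorderExpFrom (I : IKEP) (Cnat : Finset (List ℕ))
    (f : Finset (List ℕ) → ℝ) : ℝ :=
  let avail := I.G.verts \ Cnat.biUnion List.toFinset
  let XL := XList I.G I.prm.icl avail
  ((XL.permutations.map fun ord => stepExp I.G I.prm f (greedy [] ord) Cnat).sum) /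
    (XL.permutations.length : ℝ)

/-- A national `Γ`-cycle packing (only the national cycle limits `ncl` are
relevant). -/
def IsNatPacking {n : ℕ} (G : PartGraph n) (ncl : Fin n → ℕ∞)
    (P : Finset (List ℕ)) : Prop :=
  IsPacking G P ∧ ∀ l ∈ P, ∃ i, IsNationalTo G l i ∧ (l.length : ℕ∞) ≤ ncl i

/-- A maximum national `Γ`-cycle packing. -/
def IsMaxNatPacking {n : ℕ} (G : PartGraph n) (ncl : Fin n → ℕ∞)
    (P : Finset (List ℕ)) : Prop :=
  IsNatPacking G ncl P ∧ ∀ Q, IsNatPacking G ncl Q → packSize Q ≤ packSize P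

/-- A pre-selection function `σ`: it assigns to every partitioned graph and
every national cycle-limit vector a maximum national `Γ`-cycle packing
(depending only on these data). -/
structure PreSelection where
  sel : (n : ℕ) → PartGraph n → (Fin n → ℕ∞) → Finset (List ℕ)
  isMax : ∀ (n : ℕ) (G : PartGraph n) (ncl : Fin n → ℕ∞),
    IsMaxNatPacking G ncl (sel n G ncl)

/-- The expected value of `f` of the packing returned by `ℳ_order` (with
pre-selection function `σ`) on input `I`. -/
noncomputable def MorderExp (σ : PreSelection) (I : IKEP)
    (f : Finset (List ℕ) → ℝ) : ℝ :=
  MorderExpFrom I (σ.sel I.n I.G I.prm.ncl) f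

/-- The expected utility `U_i(ℳ_order(I))` of country `i`. -/
noncomputable def MorderU (σ : PreSelection) (I : IKEP) (i : Fin I.n) : ℝ :=
  MorderExp σ I fun P => (packUtil I.G i P : ℝ)

/-- The expected social welfare `SW(ℳ_order(I))`: the expected size of the
returned packing. -/
noncomputable def MorderSW (σ : PreSelection) (I : IKEP) : ℝ :=
  MorderExp σ I fun P => (packSize P : ℝ)


/-- Every vertex of a cycle has a successor on it. -/
lemma IsCycle.exists_arc {n : ℕ} {G : PartGraph n} {l : List ℕ} (h : IsCycle G l)
    {v : ℕ} (hv : v ∈ l) : ∃ w ∈ l, (v, w) ∈ G.arcs := by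
  obtain ⟨k, hk, rfl⟩ := List.mem_iff_getElem.mp hv
  have hlt : (k + 1) % l.length < l.length := Nat.mod_lt _ (by omega)
  have harc := h.2.2.2 k hk
  simp only [cyc, Nat.mod_eq_of_lt hk, List.getD_eq_getElem _ _ hk,
    List.getD_eq_getElem _ _ hlt] at harc
  exact ⟨_, List.getElem_mem hlt, harc⟩

/-- The 4-cycle `0 → 1 → 2 → 3 → 0` together with the arc `1 → 0`; the vertices
`0, 1, 2` form one country and the vertex `3` the other one. -/
def chordedSquare : PartGraph 2 where
  verts := {0, 1, 2, 3}
  arcs := {(0, 1), (1, 0), (1, 2), (2, 3), (3, 0)}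
  arcs_mem := by decide
  no_loops := by simp; omega
  country v := if v = 3 then 1 else 0
  country_nonempty := by decide

/-- Parameters without international restrictions, where national cycles have
length at most `m` in country `0` and are forbidden in country `1`. -/
def nationalLimit (m : ℕ∞) (hm : m ≠ 1) : Params 2 where
  icl := ⊤
  ncl := ![m, 0]
  iss _ := ⊤
  isn _ := ⊤
  icl_ne_one := by simp
  ncl_ne_one := by simp [Fin.forall_fin_two, hm]
  iss_pos := by simp
  isn_pos := by simp

lemma mem_arcs_chordedSquare {v w : ℕ} : (v, w) ∈ chordedSquare.arcs ↔
    v = 0 ∧ w = 1 ∨ v = 1 ∧ w = 0 ∨ v = 1 ∧ w = 2 ∨ v = 2 ∧ w = 3 ∨ v = 3 ∧ w = 0 := by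
  simp [chordedSquare]

lemma isCycle_pair : IsCycle chordedSquare [0, 1] := by
  refine ⟨by simp, by simp, by simp [chordedSquare], ?_⟩
  intro k hk
  simp only [List.length_cons, List.length_nil] at hk
  interval_cases k <;> simp [cyc, chordedSquare]

lemma isCycle_square : IsCycle chordedSquare [0, 1, 2, 3] := by
  refine ⟨by simp, by simp, by simp [chordedSquare], ?_⟩
  intro k hk
  simp only [List.length_cons, List.length_nil] at hk
  interval_cases k <;> simp [cyc, chordedSquare]

lemma zero_mem_of_isCycle {l : List ℕ} (h : IsCycle chordedSquare l) : 0 ∈ l := by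
  have h3 : 3 ∈ l → 0 ∈ l := fun hv => by
    obtain ⟨w, hw, ha⟩ := h.exists_arc hv
    rw [mem_arcs_chordedSquare] at ha
    obtain rfl : w = 0 := by omega
    exact hw
  have h2 : 2 ∈ l → 0 ∈ l := fun hv => by
    obtain ⟨w, hw, ha⟩ := h.exists_arc hv
    rw [mem_arcs_chordedSquare] at ha
    obtain rfl : w = 3 := by omega
    exact h3 hw
  have h1 : 1 ∈ l → 0 ∈ l := fun hv => by
    obtain ⟨w, hw, ha⟩ := h.exists_arc hv
    rw [mem_arcs_chordedSquare] at ha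
    obtain rfl | rfl : w = 0 ∨ w = 2 := by omega
    · exact hw
    · exact h2 hw
  have hl := h.1
  obtain ⟨v, hv⟩ : ∃ v, v ∈ l := List.exists_mem_of_length_pos (by omega)
  have hm := h.2.2.1 v hv
  simp only [chordedSquare, Finset.mem_insert, Finset.mem_singleton] at hm
  obtain rfl | rfl | rfl | rfl := hm
  exacts [hv, h1 hv, h2 hv, h3 hv]

lemma eq_of_isCycle_of_head_zero {t : List ℕ} (h : IsCycle chordedSquare (0 :: t)) :
    0 :: t = [0, 1] ∨ 0 :: t = [0, 1, 2, 3] := by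
  obtain ⟨hlen, hnd, -, harc⟩ := h
  simp only [mem_arcs_chordedSquare] at harc
  match t with
  | [] => simp at hlen
  | [a] =>
    have h0 := harc 0 (by simp)
    simp [cyc] at h0
    simp [h0]
  | [a, b] =>
    have h0 := harc 0 (by simp)
    have h1 := harc 1 (by simp)
    have h2 := harc 2 (by simp)
    simp [cyc] at h0 h1 h2 hnd
    omega
  | [a, b, c] =>
    have h0 := harc 0 (by simp)
    have h1 := harc 1 (by simp)
    have h2 := harc 2 (by simp)
    simp [cyc] at h0 h1 h2 hnd
    right
    simp
    omega
  | a :: b :: c :: d :: u =>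
    have h0 := harc 0 (by simp)
    have h1 := harc 1 (by simp)
    have h2 := harc 2 (by simp)
    have h3 := harc 3 (by simp)
    have hmod : ∀ k < 5, k % (u.length + 1 + 1 + 1 + 1 + 1) = k :=
      fun k hk => Nat.mod_eq_of_lt (by omega)
    simp [cyc, hmod] at h0 h1 h2 h3 hnd
    omega

lemma eq_of_isCycle_of_length_eq_two {l : List ℕ} (h : IsCycle chordedSquare l)
    (hl : l.length = 2) : l = [0, 1] ∨ l = [1, 0] := by
  obtain ⟨a, b, rfl⟩ := List.length_eq_two.mp hl
  have harc := h.2.2.2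
  simp only [mem_arcs_chordedSquare] at harc
  have h0 := harc 0 (by simp)
  have h1 := harc 1 (by simp)
  simp [cyc] at h0 h1
  simp
  omega

lemma isInternational_square : IsInternational chordedSquare [0, 1, 2, 3] := by
  rintro ⟨i, hi⟩
  have h0 := hi 0 (by simp)
  have h3 := hi 3 (by simp)
  rw [← h3] at h0
  simp [chordedSquare] at h0

lemma isNationalTo_pair : IsNationalTo chordedSquare [0, 1] 0 := by
  simp [IsNationalTo, chordedSquare]

lemma xCond_square_iff {l : List ℕ} :
    XCond chordedSquare ⊤ chordedSquare.verts l ↔ l = [0, 1, 2, 3] := by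
  constructor
  · rintro ⟨hc, -, hint, -, hcan⟩
    have h0 := hcan 0 (zero_mem_of_isCycle hc)
    match l with
    | [] => simpa using hc.1
    | a :: t =>
      obtain rfl : a = 0 := by simpa using h0
      rcases eq_of_isCycle_of_head_zero hc with h | h
      · rw [h] at hint
        exact absurd ⟨0, isNationalTo_pair⟩ hint
      · exact h
  · rintro rfl
    exact ⟨isCycle_square, isCycle_square.2.2.1, isInternational_square, le_top,
      by simp [IsCanon]⟩

lemma XList_square : XList chordedSquare ⊤ chordedSquare.verts = [[0, 1, 2, 3]] := by
  have h : (XCond_finite chordedSquare ⊤ chordedSquare.verts).toFinset = {[0, 1, 2, 3]} := by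
    ext l
    simp [xCond_square_iff]
  rw [XList, h, Finset.toList_singleton]

lemma XList_eq_nil {avail : Finset ℕ} (h : 0 ∉ avail) : XList chordedSquare ⊤ avail = [] := by
  have he : (XCond_finite chordedSquare ⊤ avail).toFinset = ∅ := by
    ext l
    simp only [Set.Finite.mem_toFinset, Set.mem_ofPred_eq, Finset.notMem_empty, iff_false]
    exact fun hl => h (hl.2.1 0 (zero_mem_of_isCycle hl.1))
  rw [XList, he, Finset.toList_empty]

lemma isGammaCycle_square {m : ℕ∞} {hm : m ≠ 1} :
    IsGammaCycle chordedSquare (nationalLimit m hm) [0, 1, 2, 3] :=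
  ⟨isCycle_square, Or.inr ⟨isInternational_square, le_top, fun _ _ _ _ => le_top,
    fun _ => le_top⟩⟩

lemma eq_of_isMaxNatPacking_two {P : Finset (List ℕ)}
    (h : IsMaxNatPacking chordedSquare ![2, 0] P) : P = {[0, 1]} ∨ P = {[1, 0]} := by
  obtain ⟨⟨hP, hnat⟩, hmax⟩ := h
  have hmem : ∀ l ∈ P, l = [0, 1] ∨ l = [1, 0] := by
    intro l hl
    obtain ⟨i, -, hi⟩ := hnat l hl
    have hc := hP.1 l hl
    refine eq_of_isCycle_of_length_eq_two hc (le_antisymm ?_ hc.1)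
    fin_cases i
    · change (l.length : ℕ∞) ≤ 2 at hi
      exact_mod_cast hi
    · change (l.length : ℕ∞) ≤ 0 at hi
      have : l.length ≤ 0 := by exact_mod_cast hi
      omega
  have hne : P.Nonempty := by
    rw [Finset.nonempty_iff_ne_empty]
    rintro rfl
    have := hmax {[0, 1]} ⟨⟨by simpa using isCycle_pair, by simp⟩, by
      simp only [Finset.mem_singleton, forall_eq]
      exact ⟨0, isNationalTo_pair, by simp⟩⟩
    simp [packSize] at this
  obtain ⟨l, hl⟩ := hne
  have hP' : P = {l} := by
    refine Finset.eq_singleton_iff_unique_mem.mpr ⟨hl, fun l' hl' => ?_⟩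
    by_contra hne
    refine hP.2 l' hl' l hl hne 0 ?_ ?_
    · rcases hmem l' hl' with rfl | rfl <;> simp
    · rcases hmem l hl with rfl | rfl <;> simp
  rcases hmem l hl with rfl | rfl
  exacts [Or.inl hP', Or.inr hP']

lemma eq_empty_of_isNatPacking_zero {P : Finset (List ℕ)}
    (h : IsNatPacking chordedSquare ![0, 0] P) : P = ∅ := by
  refine Finset.eq_empty_of_forall_notMem fun l hl => ?_
  obtain ⟨i, -, hi⟩ := h.2 l hl
  have hlen := (h.1.1 l hl).1
  have h0 : (l.length : ℕ∞) ≤ 0 := by fin_cases i <;> exact hi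
  have : l.length ≤ 0 := by exact_mod_cast h0
  omega

lemma MorderU_two (σ : PreSelection) :
    MorderU σ ⟨2, by simp, chordedSquare, nationalLimit 2 (by simp)⟩ 0 = 2 := by
  have hσ := eq_of_isMaxNatPacking_two (σ.isMax 2 chordedSquare ![2, 0])
  rcases hσ with h | h <;>
  · simp only [MorderU, MorderExp, MorderExpFrom, nationalLimit, h]
    rw [XList_eq_nil (by simp)]
    simp [greedy, stepExp, packUtil, cycUtil, chordedSquare]

lemma MorderU_zero (σ : PreSelection) :
    MorderU σ ⟨2, by simp, chordedSquare, nationalLimit 0 (by simp)⟩ 0 = 3 := by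
  have h : σ.sel 2 chordedSquare (nationalLimit 0 (by simp)).ncl = ∅ :=
    eq_empty_of_isNatPacking_zero (σ.isMax 2 chordedSquare ![0, 0]).1
  have hicl : (nationalLimit 0 (by simp)).icl = ⊤ := rfl
  simp only [MorderU, MorderExp, MorderExpFrom, h, Finset.biUnion_empty, Finset.sdiff_empty,
    hicl, XList_square]
  have hperm : [[0, 1, 2, 3]].permutations = [[[0, 1, 2, 3]]] := by
    simp [List.permutations, List.permutationsAux_cons]
  rw [hperm]
  simp [greedy, DisjFrom, stepExp, isGammaCycle_square, packUtil, cycUtil]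
  simp [chordedSquare]

/-- `ℳ_order` is not incentive compatible with respect to the
national cycle limits: there are an instance `⟨G,𝒱,Γ⟩`, a country `j`, and a
parameter set `Γ''` differing from `Γ` only in that `ncl''_j < ncl_j`, such
that for every pre-selection function `σ`, country `j` strictly increases its
expected utility by reporting `Γ''` instead of `Γ`. -/
theorem Morder_not_IC_wrt_ncl :
    ∃ (I : IKEP) (j : Fin I.n) (Γ'' : Params I.n),
      Γ''.icl = I.prm.icl ∧ Γ''.iss = I.prm.iss ∧ Γ''.isn = I.prm.isn ∧
      Γ''.ncl j < I.prm.ncl j ∧ (∀ h, h ≠ j → Γ''.ncl h = I.prm.ncl h) ∧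
      ∀ σ : PreSelection,
        MorderU σ I j < MorderU σ { I with prm := Γ'' } j := by
  refine ⟨⟨2, by simp, chordedSquare, nationalLimit 2 (by simp)⟩, (0 : Fin 2),
    nationalLimit 0 (by simp), rfl, rfl, rfl, ?_, ?_, fun σ => ?_⟩
  · simp [nationalLimit]
  · simp [nationalLimit, Fin.forall_fin_two]
  · exact (MorderU_two σ).trans_lt ((by norm_num : (2 : ℝ) < 3).trans_eq (MorderU_zero σ).symm)
end

section
/- There exists no mechanism that is both near-perfect and individually rational: for every (randomised) mechanism ℳ, if for every IKEP instance I whose compatibility graph admits a Γ-cycle packing covering all but at most one vertex the distribution ℳ(I) returns, with probability 1, a Γ-cycle packing covering all but at most one vertex, then ℳ is not individually rational. -/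
open scoped Classical

/-- The set of vertices of `G` covered by none of the cycles of `P`. -/
noncomputable def uncovered (I : IKEP) (P : Finset (List ℕ)) : Finset ℕ :=
  I.G.verts.filter fun v => ∀ l ∈ P, v ∉ l

/-- A near-perfect mechanism: on every instance admitting a `Γ`-cycle packing
covering all but at most one vertex, it returns (with probability 1) a
`Γ`-cycle packing covering all but at most one vertex. -/
def NearPerfectMech (M : Mechanism) : Prop :=
  ∀ I : IKEP, (∃ P, IsGammaPacking I P ∧ (uncovered I P).card ≤ 1) →
    ∀ P, M.dist I P ≠ 0 → (uncovered I P).card ≤ 1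

theorem cyc_mem {l : List ℕ} (hl : 0 < l.length) (k : ℕ) : cyc l k ∈ l := by
  have hk : k % l.length < l.length := Nat.mod_lt _ hl
  rw [cyc, List.getD_eq_getElem l 0 hk]
  exact List.getElem_mem hk

/-- Distinct positions of a duplicate-free list carry distinct vertices. -/
theorem cyc_inj {l : List ℕ} (hl : l.Nodup) {j k : ℕ} (hj : j < l.length) (hk : k < l.length)
    (h : cyc l j = cyc l k) : j = k := by
  rw [cyc, cyc, Nat.mod_eq_of_lt hj, Nat.mod_eq_of_lt hk, List.getD_eq_getElem l 0 hj,
    List.getD_eq_getElem l 0 hk] at h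
  exact (hl.getElem_inj_iff).1 h

/-- Every vertex of a list is the cyclic successor of some position. -/
theorem exists_cyc_succ_eq {l : List ℕ} {v : ℕ} (hv : v ∈ l) :
    ∃ k < l.length, cyc l (k + 1) = v := by
  obtain ⟨j, hj, rfl⟩ := List.getElem_of_mem hv
  rcases j with _ | j
  · refine ⟨l.length - 1, by omega, ?_⟩
    rw [cyc, Nat.sub_add_cancel hj, Nat.mod_self, List.getD_eq_getElem l 0 hj]
  · refine ⟨j, by omega, ?_⟩
    rw [cyc, Nat.mod_eq_of_lt hj, List.getD_eq_getElem l 0 hj]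

theorem IsCycle.exists_pred {n : ℕ} {G : PartGraph n} {l : List ℕ} (hl : IsCycle G l) {v : ℕ}
    (hv : v ∈ l) : ∃ k < l.length, cyc l (k + 1) = v ∧ (cyc l k, v) ∈ G.arcs := by
  obtain ⟨k, hk, rfl⟩ := exists_cyc_succ_eq hv
  exact ⟨k, hk, rfl, hl.2.2.2 k hk⟩

/-- If `u` is the only in-neighbour of `v`, every cycle through `v` passes through `u`. -/
theorem IsCycle.mem_of_unique_pred {n : ℕ} {G : PartGraph n} {l : List ℕ} (hl : IsCycle G l)
    {u v : ℕ} (huv : ∀ w, (w, v) ∈ G.arcs → w = u) (hv : v ∈ l) : u ∈ l := by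
  obtain ⟨k, -, -, h⟩ := hl.exists_pred hv
  exact huv _ h ▸ cyc_mem (by have := hl.1; omega) k

/-- Two vertices with the same unique in-neighbour cannot lie on a common cycle. -/
theorem IsCycle.eq_of_unique_pred {n : ℕ} {G : PartGraph n} {l : List ℕ} (hl : IsCycle G l)
    {u v w : ℕ} (hv : ∀ x, (x, v) ∈ G.arcs → x = u) (hw : ∀ x, (x, w) ∈ G.arcs → x = u)
    (hvl : v ∈ l) (hwl : w ∈ l) : v = w := by
  obtain ⟨j, hj, rfl, hjv⟩ := hl.exists_pred hvl
  obtain ⟨k, hk, rfl, hkw⟩ := hl.exists_pred hwl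
  rw [cyc_inj hl.2.1 hj hk ((hv _ hjv).trans (hw _ hkw).symm)]

theorem IsPacking.packSize_le {n : ℕ} {G : PartGraph n} {P : Finset (List ℕ)}
    (hP : IsPacking G P) : packSize P ≤ G.verts.card := by
  have hcard : packSize P = (P.biUnion List.toFinset).card := by
    rw [Finset.card_biUnion]
    · exact Finset.sum_congr rfl fun l hl =>
        (List.toFinset_card_of_nodup (hP.1 l hl).2.1).symm
    · intro l hl l' hl' hne
      rw [Function.onFun, Finset.disjoint_left]
      intro v hv hv'
      exact hP.2 l hl l' hl' hne v (List.mem_toFinset.1 hv) (List.mem_toFinset.1 hv')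
  rw [hcard]
  refine Finset.card_le_card fun v hv => ?_
  obtain ⟨l, hl, hv⟩ := Finset.mem_biUnion.1 hv
  exact (hP.1 l hl).2.2.1 v (List.mem_toFinset.1 hv)

theorem packSize_le_natSize {I : IKEP} {i : Fin I.n} {P : Finset (List ℕ)}
    (hP : IsPacking I.G P) (hnat : ∀ l ∈ P, IsNationalTo I.G l i)
    (hlen : ∀ l ∈ P, (l.length : ℕ∞) ≤ I.prm.ncl i) : packSize P ≤ natSize I i := by
  refine le_csSup ⟨I.G.verts.card, ?_⟩ ⟨P, hP, hnat, hlen, rfl⟩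
  rintro _ ⟨Q, hQ, -, -, rfl⟩
  exact hQ.packSize_le

theorem isPacking_singleton {n : ℕ} {G : PartGraph n} {l : List ℕ} (hl : IsCycle G l) :
    IsPacking G {l} := by
  simp [IsPacking, hl]

theorem expUtil_le {M : Mechanism} {I : IKEP} {i : Fin I.n} {b : ℕ}
    (hb : ∀ P, M.dist I P ≠ 0 → packUtil I.G i P ≤ b) : expUtil M I i ≤ b := by
  calc expUtil M I i ≤ (M.dist I).sum fun _ p => p * (b : ℝ) :=
        Finset.sum_le_sum fun P hP => mul_le_mul_of_nonneg_left
          (Nat.cast_le.2 (hb P (Finsupp.mem_support_iff.1 hP))) (M.nonneg I P)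
    _ = b := by
        rw [← Finsupp.sum_mul, M.sum_one, one_mul]

/-- A national 2-cycle `0 1` of country `0` and an international 3-cycle `0 2 3` that leaves
only `1` uncovered. -/
def conflictGraph : PartGraph 2 where
  verts := {0, 1, 2, 3}
  arcs := {(0, 1), (1, 0), (0, 2), (2, 3), (3, 0)}
  arcs_mem := by simp
  no_loops v := by simp; omega
  country v := if v < 2 then 0 else 1
  country_nonempty := by
    intro i
    fin_cases i
    · exact ⟨0, by simp⟩
    · exact ⟨2, by simp⟩

/-- The instance on `conflictGraph` without any restrictions on the cycles. -/
def conflictInstance : IKEP where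
  n := 2
  npos := by norm_num
  G := conflictGraph
  prm :=
    { icl := ⊤
      ncl := fun _ => ⊤
      iss := fun _ => ⊤
      isn := fun _ => ⊤
      icl_ne_one := by simp
      ncl_ne_one := by simp
      iss_pos := by simp
      isn_pos := by simp }

theorem isCycle_national : IsCycle conflictGraph [0, 1] := by
  refine ⟨by simp, by simp, by simp [conflictGraph], fun k hk => ?_⟩
  simp only [List.length_cons, List.length_nil] at hk
  interval_cases k <;> simp [conflictGraph, cyc]

theorem isCycle_international : IsCycle conflictGraph [0, 2, 3] := by
  refine ⟨by simp, by simp, by simp [conflictGraph], fun k hk => ?_⟩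
  simp only [List.length_cons, List.length_nil] at hk
  interval_cases k <;> simp [conflictGraph, cyc]

theorem isInternational_conflict : IsInternational conflictGraph [0, 2, 3] := by
  rintro ⟨i, hi⟩
  have h0 := hi 0 (by simp)
  have h2 := hi 2 (by simp)
  rw [← h2] at h0
  simp [conflictGraph] at h0

theorem exists_nearPerfect_conflict :
    ∃ P, IsGammaPacking conflictInstance P ∧ (uncovered conflictInstance P).card ≤ 1 := by
  refine ⟨{[0, 2, 3]}, ⟨isPacking_singleton isCycle_international, ?_⟩, ?_⟩
  · intro l hl
    obtain rfl := Finset.mem_singleton.1 hl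
    exact ⟨isCycle_international, Or.inr ⟨isInternational_conflict, le_top,
      fun _ _ _ _ => le_top, fun _ => le_top⟩⟩
  · rw [Finset.card_le_one_iff_subset_singleton]
    refine ⟨1, fun v hv => ?_⟩
    simp [uncovered, conflictInstance, conflictGraph] at hv ⊢
    omega

theorem two_le_natSize_conflict : 2 ≤ natSize conflictInstance (0 : Fin 2) := by
  refine le_of_eq_of_le ?_ (packSize_le_natSize (I := conflictInstance) (i := (0 : Fin 2))
    (P := {[0, 1]}) (isPacking_singleton isCycle_national) ?_ fun _ _ => le_top)
  · simp [packSize]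
  · simp [IsNationalTo, conflictInstance, conflictGraph]

theorem eq_zero_of_arc_one {w : ℕ} (h : (w, 1) ∈ conflictGraph.arcs) : w = 0 := by
  simpa [conflictGraph] using h

theorem eq_zero_of_arc_two {w : ℕ} (h : (w, 2) ∈ conflictGraph.arcs) : w = 0 := by
  simpa [conflictGraph] using h

theorem eq_two_of_arc_three {w : ℕ} (h : (w, 3) ∈ conflictGraph.arcs) : w = 2 := by
  simpa [conflictGraph] using h

theorem zero_mem_of_isCycle_conflict {l : List ℕ} (hl : IsCycle conflictGraph l) : 0 ∈ l := by
  have h2 : 2 ∈ l → 0 ∈ l := hl.mem_of_unique_pred fun _ => eq_zero_of_arc_two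
  have hpos : 0 < l.length := by have := hl.1; omega
  have hv := cyc_mem hpos 0
  have hG := hl.2.2.1 _ hv
  simp only [conflictGraph, Finset.mem_insert, Finset.mem_singleton] at hG
  rcases hG with h | h | h | h <;> rw [h] at hv
  · exact hv
  · exact hl.mem_of_unique_pred (fun _ => eq_zero_of_arc_one) hv
  · exact h2 hv
  · exact h2 (hl.mem_of_unique_pred (fun _ => eq_two_of_arc_three) hv)

/-- Any two cycles of `conflictGraph` meet, so its nonempty packings are single cycles. -/
theorem eq_of_mem_packing_conflict {P : Finset (List ℕ)} (hP : IsPacking conflictGraph P)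
    {l l' : List ℕ} (hl : l ∈ P) (hl' : l' ∈ P) : l = l' := by
  by_contra hne
  exact hP.2 l hl l' hl' hne 0 (zero_mem_of_isCycle_conflict (hP.1 l hl))
    (zero_mem_of_isCycle_conflict (hP.1 l' hl'))

theorem one_notMem_of_nearPerfect_conflict {P : Finset (List ℕ)}
    (hP : IsPacking conflictGraph P) (hcard : (uncovered conflictInstance P).card ≤ 1)
    {l : List ℕ} (hl : l ∈ P) : 1 ∉ l := by
  intro h1
  have hc := hP.1 l hl
  have h2 : 2 ∉ l := fun h2 => absurd
    (hc.eq_of_unique_pred (fun _ => eq_zero_of_arc_one) (fun _ => eq_zero_of_arc_two) h1 h2)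
    (by norm_num)
  have h3 : 3 ∉ l := fun h3 => h2 (hc.mem_of_unique_pred (fun _ => eq_two_of_arc_three) h3)
  have hunc : ∀ v ∈ conflictGraph.verts, v ∉ l → v ∈ uncovered conflictInstance P :=
    fun v hv hvl => Finset.mem_filter.2
      ⟨hv, fun l' hl' => eq_of_mem_packing_conflict hP hl hl' ▸ hvl⟩
  have := Finset.card_le_one.1 hcard 2 (hunc 2 (by simp [conflictGraph]) h2) 3
    (hunc 3 (by simp [conflictGraph]) h3)
  omega

theorem packUtil_le_one_conflict {P : Finset (List ℕ)} (hP : IsPacking conflictGraph P)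
    (hcard : (uncovered conflictInstance P).card ≤ 1) :
    packUtil conflictGraph 0 P ≤ 1 := by
  rcases P.eq_empty_or_nonempty with rfl | ⟨l, hl⟩
  · simp [packUtil]
  have hPl : P = {l} := Finset.eq_singleton_iff_unique_mem.2
    ⟨hl, fun l' hl' => eq_of_mem_packing_conflict hP hl' hl⟩
  have h1 := one_notMem_of_nearPerfect_conflict hP hcard hl
  rw [hPl, packUtil, Finset.sum_singleton, cycUtil,
    ← List.toFinset_card_of_nodup ((hP.1 l hl).2.1.filter _),
    Finset.card_le_one_iff_subset_singleton]
  refine ⟨0, fun v hv => ?_⟩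
  simp only [List.mem_toFinset, List.mem_filter, conflictGraph] at hv
  have hne : v ≠ 1 := fun h => h1 (h ▸ hv.1)
  have hlt : v < 2 := by
    by_contra hge
    simp [hge] at hv
  exact Finset.mem_singleton.2 (by omega)

/-- There is no mechanism that is both near-perfect and
individually rational. -/
theorem no_nearPerfect_and_IR (M : Mechanism) (h : NearPerfectMech M) :
    ¬ IndRational M := by
  intro hIR
  have hnat : (2 : ℝ) ≤ natSize conflictInstance (0 : Fin 2) := by
    exact_mod_cast two_le_natSize_conflict
  have hutil : expUtil M conflictInstance (0 : Fin 2) ≤ (1 : ℕ) := expUtil_le fun P hP =>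
    packUtil_le_one_conflict (M.supp _ P hP).1
      (h conflictInstance exists_nearPerfect_conflict P hP)
  have hle := hIR conflictInstance (0 : Fin 2)
  norm_num at hutil
  linarith
end
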